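/- Suppose the field F has more than n−k elements, 1 < k < n−1 and k ≤ n−3. Then there is a graph isomorphism between Γ_t and the Grassmann graph Γ_k(V) whose restriction to the set of non-degenerate k-dimensional subspaces is the identity. -/

import Mathlib

open Module

section Defs

variable (F : Type*) [Field F]

/-- The `i`-th coordinate hyperplane in `F^n`: the kernel of the `i`-th coordinate functional. -/
def coordHyp (n : ℕ) (i : Fin n) : Submodule F (Fin n → F) :=
  LinearMap.ker (LinearMap.proj (R := F) (φ := fun _ : Fin n => F) i)

/-- A subspace of `F^n` is degenerate if it is contained in some coordinate hyperplane. -/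
def IsDeg (n : ℕ) (W : Submodule F (Fin n → F)) : Prop :=
  ∃ i : Fin n, W ≤ coordHyp F n i

/-- A subspace of `F^n` is non-degenerate if it is not degenerate. -/
def IsNondeg (n : ℕ) (W : Submodule F (Fin n → F)) : Prop :=
  ¬ IsDeg F n W

/-- Adjacency of `k`-dimensional subspaces: distinct with `(k-1)`-dimensional intersection. -/
def AdjK (n k : ℕ) (A B : Submodule F (Fin n → F)) : Prop :=
  A ≠ B ∧ finrank F ↥(A ⊓ B) = k - 1

/-- The star `S(X)`: all `k`-dimensional subspaces containing `X`. -/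
def Sstar (n k : ℕ) (X : Submodule F (Fin n → F)) : Set (Submodule F (Fin n → F)) :=
  {A | finrank F ↥A = k ∧ X ≤ A}

/-- `S^c(X)`: all non-degenerate `k`-dimensional subspaces containing `X`. -/
def Sc (n k : ℕ) (X : Submodule F (Fin n → F)) : Set (Submodule F (Fin n → F)) :=
  {A | finrank F ↥A = k ∧ X ≤ A ∧ IsNondeg F n A}

/-- `T^c(Y)`: all non-degenerate `k`-dimensional subspaces contained in `Y`. -/
def Tc (n k : ℕ) (Y : Submodule F (Fin n → F)) : Set (Submodule F (Fin n → F)) :=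
  {A | finrank F ↥A = k ∧ A ≤ Y ∧ IsNondeg F n A}

/-- A clique of `Δ_k(V)`: a set of non-degenerate `k`-dimensional subspaces which are
pairwise adjacent. -/
def IsCliqueD (n k : ℕ) (C : Set (Submodule F (Fin n → F))) : Prop :=
  (∀ A ∈ C, finrank F ↥A = k ∧ IsNondeg F n A) ∧
    ∀ A ∈ C, ∀ B ∈ C, A ≠ B → AdjK F n k A B

/-- A maximal clique of `Δ_k(V)`. -/
def IsMaxCliqueD (n k : ℕ) (C : Set (Submodule F (Fin n → F))) : Prop :=
  IsCliqueD F n k C ∧ ∀ D, IsCliqueD F n k D → C ⊆ D → D = C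

/-- A star of `Δ_k(V)`: a set `S^c(X)` which is a maximal clique of `Δ_k(V)`. -/
def IsStarD (n k : ℕ) (S : Set (Submodule F (Fin n → F))) : Prop :=
  (∃ X : Submodule F (Fin n → F), finrank F ↥X = k - 1 ∧ S = Sc F n k X) ∧
    IsMaxCliqueD F n k S

/-- A top of `Δ_k(V)`: a set `T^c(Y)` which is a maximal clique of `Δ_k(V)`. -/
def IsTopD (n k : ℕ) (T : Set (Submodule F (Fin n → F))) : Prop :=
  (∃ Y : Submodule F (Fin n → F), finrank F ↥Y = k + 1 ∧ T = Tc F n k Y) ∧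
    IsMaxCliqueD F n k T

/-- Adjacency of maximal cliques used in the graphs `Δ_s` and `Δ_t`:
two distinct cliques such that every vertex of each is adjacent to some vertex of the other. -/
def AdjMC (n k : ℕ) (C1 C2 : Set (Submodule F (Fin n → F))) : Prop :=
  C1 ≠ C2 ∧ (∀ A ∈ C1, ∃ B ∈ C2, AdjK F n k A B) ∧
    (∀ A ∈ C2, ∃ B ∈ C1, AdjK F n k A B)

/-- Adjacency in the graphs `Δ'_s` and `Δ'_t`: adjacent as above with empty intersection. -/
def AdjMC' (n k : ℕ) (C1 C2 : Set (Submodule F (Fin n → F))) : Prop :=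
  AdjMC F n k C1 C2 ∧ C1 ∩ C2 = ∅

/-- A clique of the graph `Δ_s` (whose vertices are the stars of `Δ_k(V)`). -/
def IsCliqueDs (n k : ℕ) (𝔖 : Set (Set (Submodule F (Fin n → F)))) : Prop :=
  (∀ S ∈ 𝔖, IsStarD F n k S) ∧ ∀ S ∈ 𝔖, ∀ S' ∈ 𝔖, S ≠ S' → AdjMC F n k S S'

/-- A maximal clique of `Δ_s`. -/
def IsMaxCliqueDs (n k : ℕ) (𝔖 : Set (Set (Submodule F (Fin n → F)))) : Prop :=
  IsCliqueDs F n k 𝔖 ∧ ∀ 𝔖', IsCliqueDs F n k 𝔖' → 𝔖 ⊆ 𝔖' → 𝔖' = 𝔖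

/-- A clique of the graph `Δ'_s`. -/
def IsCliqueDs' (n k : ℕ) (𝔖 : Set (Set (Submodule F (Fin n → F)))) : Prop :=
  (∀ S ∈ 𝔖, IsStarD F n k S) ∧ ∀ S ∈ 𝔖, ∀ S' ∈ 𝔖, S ≠ S' → AdjMC' F n k S S'

/-- A maximal clique of `Δ'_s`. -/
def IsMaxCliqueDs' (n k : ℕ) (𝔖 : Set (Set (Submodule F (Fin n → F)))) : Prop :=
  IsCliqueDs' F n k 𝔖 ∧ ∀ 𝔖', IsCliqueDs' F n k 𝔖' → 𝔖 ⊆ 𝔖' → 𝔖' = 𝔖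

/-- A special set of stars: a maximal clique in both `Δ_s` and `Δ'_s`. -/
def IsSpecialStars (n k : ℕ) (𝔖 : Set (Set (Submodule F (Fin n → F)))) : Prop :=
  IsMaxCliqueDs F n k 𝔖 ∧ IsMaxCliqueDs' F n k 𝔖

/-- A clique of the graph `Δ_t` (whose vertices are the tops of `Δ_k(V)`). -/
def IsCliqueDt (n k : ℕ) (𝔗 : Set (Set (Submodule F (Fin n → F)))) : Prop :=
  (∀ T ∈ 𝔗, IsTopD F n k T) ∧ ∀ T ∈ 𝔗, ∀ T' ∈ 𝔗, T ≠ T' → AdjMC F n k T T'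

/-- A maximal clique of `Δ_t`. -/
def IsMaxCliqueDt (n k : ℕ) (𝔗 : Set (Set (Submodule F (Fin n → F)))) : Prop :=
  IsCliqueDt F n k 𝔗 ∧ ∀ 𝔗', IsCliqueDt F n k 𝔗' → 𝔗 ⊆ 𝔗' → 𝔗' = 𝔗

/-- A clique of the graph `Δ'_t`. -/
def IsCliqueDt' (n k : ℕ) (𝔗 : Set (Set (Submodule F (Fin n → F)))) : Prop :=
  (∀ T ∈ 𝔗, IsTopD F n k T) ∧ ∀ T ∈ 𝔗, ∀ T' ∈ 𝔗, T ≠ T' → AdjMC' F n k T T'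

/-- A maximal clique of `Δ'_t`. -/
def IsMaxCliqueDt' (n k : ℕ) (𝔗 : Set (Set (Submodule F (Fin n → F)))) : Prop :=
  IsCliqueDt' F n k 𝔗 ∧ ∀ 𝔗', IsCliqueDt' F n k 𝔗' → 𝔗 ⊆ 𝔗' → 𝔗' = 𝔗

/-- A special set of tops: a maximal clique in both `Δ_t` and `Δ'_t`. -/
def IsSpecialTops (n k : ℕ) (𝔗 : Set (Set (Submodule F (Fin n → F)))) : Prop :=
  IsMaxCliqueDt F n k 𝔗 ∧ IsMaxCliqueDt' F n k 𝔗

/-- `𝔗_X`: the set of all `T^c(Y)` over non-degenerate `(k+1)`-dimensional `Y` containing `X`. -/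
def TopsThrough (n k : ℕ) (X : Submodule F (Fin n → F)) :
    Set (Set (Submodule F (Fin n → F))) :=
  {T | ∃ Y : Submodule F (Fin n → F),
    finrank F ↥Y = k + 1 ∧ IsNondeg F n Y ∧ X ≤ Y ∧ T = Tc F n k Y}

end Defs
/-- The Grassmann graph `Γ_k(V)`: vertices are the `k`-dimensional subspaces of `F^n`,
two distinct ones being adjacent when their intersection is `(k-1)`-dimensional. -/
def GrassmannGraph (F : Type*) [Field F] (n k : ℕ) :
    SimpleGraph {A : Submodule F (Fin n → F) // finrank F ↥A = k} :=
  SimpleGraph.fromRel fun A B => finrank F ↥(A.1 ⊓ B.1) = k - 1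

/-- The graph `Γ_t`: vertices are the non-degenerate `k`-dimensional subspaces together
with the special sets of tops; a subspace is joined to a special set iff it belongs to some
top of that set; two special sets are joined iff some star of `Δ_k(V)` meets every top of
both sets. -/
def GammaT (F : Type*) [Field F] (n k : ℕ) :
    SimpleGraph
      ({A : Submodule F (Fin n → F) // finrank F ↥A = k ∧ IsNondeg F n A} ⊕
        {𝔗 : Set (Set (Submodule F (Fin n → F))) // IsSpecialTops F n k 𝔗}) :=
  SimpleGraph.fromRel fun v w =>
    match v, w with
    | Sum.inl A, Sum.inl B => AdjK F n k A.1 B.1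
    | Sum.inl A, Sum.inr 𝔗 => ∃ T ∈ 𝔗.1, A.1 ∈ T
    | Sum.inr 𝔗, Sum.inl A => ∃ T ∈ 𝔗.1, A.1 ∈ T
    | Sum.inr 𝔗1, Sum.inr 𝔗2 =>
        ∃ S, IsStarD F n k S ∧ (∀ T ∈ 𝔗1.1, (S ∩ T).Nonempty) ∧
          (∀ T ∈ 𝔗2.1, (S ∩ T).Nonempty)

/-- A subspace is not covered by at most `m + 1` subspaces not containing it, if the field has
more than `m` elements. -/
theorem Submodule.exists_mem_forall_notMem_of_card_le {F V : Type*} [Field F] [AddCommGroup V]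
    [Module F V] {m : ℕ} (hF : ∀ t : Finset F, t.card ≤ m → ∃ c, c ∉ t) (Y : Submodule F V)
    (s : Finset (Submodule F V)) (hs : s.card ≤ m + 1) (h : ∀ p ∈ s, ¬ Y ≤ p) :
    ∃ y ∈ Y, ∀ p ∈ s, y ∉ p := by
  classical
  induction s using Finset.induction_on with
  | empty => exact ⟨0, Y.zero_mem, by simp⟩
  | insert a t ha ih =>
    rw [Finset.card_insert_of_notMem ha] at hs
    obtain ⟨y, hyY, hy⟩ := ih (by omega) fun p hp => h p (Finset.mem_insert_of_mem hp)
    by_cases hya : y ∈ a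
    · obtain ⟨z, hzY, hza⟩ := SetLike.not_le_iff_exists.1 (h a (Finset.mem_insert_self a t))
      have huniq : ∀ p ∈ t, ∃ c₀ : F, ∀ c : F, z + c • y ∈ p → c = c₀ := by
        intro p hp
        by_cases hex : ∃ c₀ : F, z + c₀ • y ∈ p
        · obtain ⟨c₀, hc₀⟩ := hex
          refine ⟨c₀, fun c hc => ?_⟩
          by_contra hne
          have hmem : (c - c₀) • y ∈ p := by
            have := p.sub_mem hc hc₀
            rwa [add_sub_add_left_eq_sub, ← sub_smul] at this
          exact hy p hp ((p.smul_mem_iff (sub_ne_zero.2 hne)).1 hmem)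
        · exact ⟨0, fun c hc => (hex ⟨c, hc⟩).elim⟩
      choose! g hg using huniq
      obtain ⟨c, hc⟩ := hF (t.image g) (Finset.card_image_le.trans (by omega))
      refine ⟨z + c • y, Y.add_mem hzY (Y.smul_mem c hyY), fun p hp hmem => ?_⟩
      rcases Finset.mem_insert.1 hp with rfl | hp
      · exact hza ((p.add_mem_iff_left (p.smul_mem c hya)).1 hmem)
      · exact hc (Finset.mem_image.2 ⟨p, hp, (hg p hp c hmem).symm⟩)
    · refine ⟨y, hyY, fun p hp => ?_⟩
      rcases Finset.mem_insert.1 hp with rfl | hp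
      · exact hya
      · exact hy p hp

theorem Submodule.exists_le_finrank_eq {F V : Type*} [Field F] [AddCommGroup V] [Module F V]
    [FiniteDimensional F V] (W : Submodule F V) {d : ℕ} (hd : d ≤ finrank F W) :
    ∃ U ≤ W, finrank F U = d := by
  induction d with
  | zero => exact ⟨⊥, bot_le, finrank_bot F V⟩
  | succ d ih =>
    obtain ⟨U, hUW, hU⟩ := ih (by omega)
    have hWU : ¬ W ≤ U := fun h => by
      have := Submodule.finrank_mono h
      omega
    obtain ⟨y, hyW, hyU⟩ := SetLike.not_le_iff_exists.1 hWU
    refine ⟨U ⊔ F ∙ y, sup_le hUW ((Submodule.span_singleton_le_iff_mem y W).2 hyW), ?_⟩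
    rw [finrank_sup_span_singleton hyU, hU]

section Extension

variable {F : Type*} [Field F] {n : ℕ}

theorem mem_coordHyp {i : Fin n} {x : Fin n → F} : x ∈ coordHyp F n i ↔ x i = 0 := by
  simp [coordHyp]

theorem IsNondeg.not_le {W : Submodule F (Fin n → F)} (h : IsNondeg F n W) (i : Fin n) :
    ¬ W ≤ coordHyp F n i := fun hi => h ⟨i, hi⟩

theorem IsNondeg.mono {W W' : Submodule F (Fin n → F)} (h : IsNondeg F n W) (hle : W ≤ W') :
    IsNondeg F n W' := fun ⟨i, hi⟩ => h ⟨i, hle.trans hi⟩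

open Classical in
/-- The coordinates vanishing identically on a subspace. -/
noncomputable def vanishingCoords (Z : Submodule F (Fin n → F)) : Finset (Fin n) :=
  Finset.univ.filter fun i => Z ≤ coordHyp F n i

theorem mem_vanishingCoords {Z : Submodule F (Fin n → F)} {i : Fin n} :
    i ∈ vanishingCoords Z ↔ Z ≤ coordHyp F n i := by
  simp [vanishingCoords]

theorem card_vanishingCoords_add_finrank_le (Z : Submodule F (Fin n → F)) :
    (vanishingCoords Z).card + finrank F Z ≤ n := by
  classical
  let f : Z →ₗ[F] ({i : Fin n // i ∉ vanishingCoords Z} → F) :=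
    (LinearMap.funLeft F F Subtype.val) ∘ₗ Z.subtype
  have hf : Function.Injective f := by
    rw [injective_iff_map_eq_zero]
    intro z hz
    ext i
    by_cases hi : i ∈ vanishingCoords Z
    · exact mem_coordHyp.1 (mem_vanishingCoords.1 hi z.2)
    · exact congrFun hz ⟨i, hi⟩
  have h := LinearMap.finrank_le_finrank_of_injective hf
  rw [finrank_fintype_fun_eq_card, Fintype.card_subtype_compl, Fintype.card_fin,
    Fintype.card_coe] at h
  have := card_finset_fin_le (vanishingCoords Z)
  omega

theorem isNondeg_sup_span_singleton {Z : Submodule F (Fin n → F)} {y : Fin n → F}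
    (h : ∀ i ∈ vanishingCoords Z, y ∉ coordHyp F n i) : IsNondeg F n (Z ⊔ F ∙ y) := by
  rintro ⟨i, hi⟩
  exact h i (mem_vanishingCoords.2 (le_sup_left.trans hi))
    (hi (Submodule.mem_sup_right (Submodule.mem_span_singleton_self y)))

theorem exists_notMem_isNondeg_sup_span_singleton {m : ℕ}
    (hF : ∀ t : Finset F, t.card ≤ m → ∃ c, c ∉ t) {Z P Y : Submodule F (Fin n → F)}
    (hY : IsNondeg F n Y) (hP : ¬ Y ≤ P) (hZ : (vanishingCoords Z).card ≤ m) :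
    ∃ y ∈ Y, y ∉ P ∧ IsNondeg F n (Z ⊔ F ∙ y) := by
  classical
  obtain ⟨y, hyY, hy⟩ := Submodule.exists_mem_forall_notMem_of_card_le hF Y
    (insert P ((vanishingCoords Z).image (coordHyp F n)))
    ((Finset.card_insert_le _ _).trans (by
      have := Finset.card_image_le (s := vanishingCoords Z) (f := coordHyp F n)
      omega))
    (by
      intro p hp
      rcases Finset.mem_insert.1 hp with rfl | hp
      · exact hP
      · obtain ⟨i, -, rfl⟩ := Finset.mem_image.1 hp
        exact hY.not_le i)
  exact ⟨y, hyY, hy P (Finset.mem_insert_self _ _), isNondeg_sup_span_singleton fun i hi =>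
    hy _ (Finset.mem_insert_of_mem (Finset.mem_image_of_mem _ hi))⟩

theorem exists_isNondeg_between {m : ℕ} (hF : ∀ t : Finset F, t.card ≤ m → ∃ c, c ∉ t)
    {Z Y : Submodule F (Fin n → F)} (hY : IsNondeg F n Y) (hZY : Z < Y)
    (hZ : (vanishingCoords Z).card ≤ m + 1) :
    ∃ A, Z ≤ A ∧ A ≤ Y ∧ IsNondeg F n A ∧ finrank F A = finrank F Z + 1 := by
  classical
  suffices h : ∃ y ∈ Y, y ∉ Z ∧ ∀ i ∈ vanishingCoords Z, y ∉ coordHyp F n i by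
    obtain ⟨y, hyY, hyZ, hy⟩ := h
    exact ⟨Z ⊔ F ∙ y, le_sup_left,
      sup_le hZY.le ((Submodule.span_singleton_le_iff_mem y Y).2 hyY),
      isNondeg_sup_span_singleton hy, Submodule.finrank_sup_span_singleton hyZ⟩
  rcases (vanishingCoords Z).eq_empty_or_nonempty with he | ⟨i, hi⟩
  · obtain ⟨y, hyY, hyZ⟩ := SetLike.exists_of_lt hZY
    exact ⟨y, hyY, hyZ, by simp [he]⟩
  · obtain ⟨y, hyY, hy⟩ := Submodule.exists_mem_forall_notMem_of_card_le hF Y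
      ((vanishingCoords Z).image (coordHyp F n)) (Finset.card_image_le.trans hZ)
      (by
        intro p hp
        obtain ⟨j, -, rfl⟩ := Finset.mem_image.1 hp
        exact hY.not_le j)
    have hy' : ∀ j ∈ vanishingCoords Z, y ∉ coordHyp F n j := fun j hj =>
      hy _ (Finset.mem_image_of_mem _ hj)
    exact ⟨y, hyY, fun hyZ => hy' i hi (mem_vanishingCoords.1 hi hyZ), hy'⟩

/-- The vectors without zero coordinates span the whole space. -/
theorem exists_notMem_forall_ne_zero (hF : ∀ t : Finset F, t.card ≤ 2 → ∃ c, c ∉ t)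
    {W : Submodule F (Fin n → F)} (hW : W ≠ ⊤) : ∃ y ∉ W, ∀ i, y i ≠ 0 := by
  classical
  by_contra! hcon
  have hfull : ∀ y : Fin n → F, (∀ i, y i ≠ 0) → y ∈ W := by
    intro y hy
    by_contra hyW
    obtain ⟨i, hi⟩ := hcon y hyW
    exact hy i hi
  obtain ⟨c, hc⟩ := hF {0, -1} Finset.card_le_two
  simp only [Finset.mem_insert, Finset.mem_singleton, not_or] at hc
  have hsingle : ∀ i : Fin n, Pi.single i (1 : F) ∈ W := by
    intro i
    have h1 : (1 : Fin n → F) ∈ W := hfull 1 fun _ => one_ne_zero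
    have h2 : (1 : Fin n → F) + c • Pi.single i (1 : F) ∈ W := by
      refine hfull _ fun j => ?_
      by_cases hj : j = i
      · subst hj
        simp only [Pi.add_apply, Pi.one_apply, Pi.smul_apply, Pi.single_eq_same, smul_eq_mul,
          mul_one]
        intro h0
        exact hc.2 (by linear_combination h0)
      · simp [hj]
    exact (W.smul_mem_iff hc.1).1 ((W.add_mem_iff_right h1).1 h2)
  refine hW (eq_top_iff.2 fun x _ => ?_)
  rw [pi_eq_sum_univ' x]
  exact W.sum_mem fun i _ => W.smul_mem _ (by
    convert hsingle i using 1)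

theorem isNondeg_sup_span_singleton_of_forall_ne_zero (Z : Submodule F (Fin n → F))
    {y : Fin n → F} (hy : ∀ i, y i ≠ 0) : IsNondeg F n (Z ⊔ F ∙ y) :=
  isNondeg_sup_span_singleton fun i _ h => hy i (mem_coordHyp.1 h)

end Extension

section Hyperplanes

variable {F V : Type*} [Field F] [AddCommGroup V] [Module F V] [FiniteDimensional F V]
  {A B Y : Submodule F V} {d : ℕ}

theorem Submodule.add_one_le_finrank_sup_of_ne (hA : finrank F A = d) (hB : finrank F B = d)
    (hne : A ≠ B) : d + 1 ≤ finrank F ↥(A ⊔ B) := by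
  have hlt : A < A ⊔ B := lt_of_le_of_ne le_sup_left fun h =>
    hne (Submodule.eq_of_le_of_finrank_eq (h ▸ le_sup_right) (hB.trans hA.symm)).symm
  have := Submodule.finrank_lt_finrank_of_lt hlt
  omega

theorem Submodule.sup_eq_of_ne_of_finrank_eq (hA : finrank F A = d) (hB : finrank F B = d)
    (hY : finrank F Y = d + 1) (hAY : A ≤ Y) (hBY : B ≤ Y) (hne : A ≠ B) : A ⊔ B = Y :=
  Submodule.eq_of_le_of_finrank_le (sup_le hAY hBY)
    (hY.trans_le (Submodule.add_one_le_finrank_sup_of_ne hA hB hne))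

theorem Submodule.finrank_inf_add_one (hA : finrank F A = d) (hB : finrank F B = d)
    (hY : finrank F Y = d + 1) (hAY : A ≤ Y) (hBY : B ≤ Y) (hne : A ≠ B) :
    finrank F ↥(A ⊓ B) + 1 = d := by
  have h := Submodule.finrank_sup_add_finrank_inf_eq A B
  rw [Submodule.sup_eq_of_ne_of_finrank_eq hA hB hY hAY hBY hne] at h
  omega

theorem Submodule.finrank_sup_eq_add_one (hA : finrank F A = d) (hB : finrank F B = d)
    (h : finrank F ↥(A ⊓ B) + 1 = d) : finrank F ↥(A ⊔ B) = d + 1 := by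
  have := Submodule.finrank_sup_add_finrank_inf_eq A B
  omega

end Hyperplanes

/-- Parameters `1 < k ≤ n - 3` together with a field having more than `n - k` elements. -/
structure AdmissibleParams (F : Type*) [Field F] (n k : ℕ) : Prop where
  two_le : 2 ≤ k
  add_three_le : k + 3 ≤ n
  exists_notMem : ∀ t : Finset F, t.card ≤ n - k → ∃ c, c ∉ t

namespace AdmissibleParams

variable {F : Type*} [Field F] {n k : ℕ}

theorem exists_notMem_forall_ne_zero (h : AdmissibleParams F n k)
    {W : Submodule F (Fin n → F)} (hW : finrank F W < n) : ∃ y ∉ W, ∀ i, y i ≠ 0 := by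
  have := h.add_three_le
  refine _root_.exists_notMem_forall_ne_zero (fun t ht => h.exists_notMem t (by omega)) ?_
  rintro rfl
  simp at hW

theorem exists_mem_Tc (h : AdmissibleParams F n k) {Z Y : Submodule F (Fin n → F)}
    (hY : IsNondeg F n Y) (hYk : finrank F Y = k + 1) (hZY : Z ≤ Y)
    (hZ : finrank F Z = k - 1) : ∃ A ∈ Tc F n k Y, Z ≤ A := by
  have := h.two_le
  have := card_vanishingCoords_add_finrank_le Z
  have hlt : Z < Y := lt_of_le_of_ne hZY (by rintro rfl; omega)
  obtain ⟨A, hZA, hAY, hA, hAk⟩ := exists_isNondeg_between h.exists_notMem hY hlt (by omega)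
  exact ⟨A, ⟨by omega, hAY, hA⟩, hZA⟩

theorem exists_mem_Tc_not_le (h : AdmissibleParams F n k) {X Y : Submodule F (Fin n → F)}
    (hY : IsNondeg F n Y) (hYk : finrank F Y = k + 1) (hXY : X ≤ Y)
    (hX : finrank F X = k - 1) : ∃ A ∈ Tc F n k Y, ¬ X ≤ A := by
  classical
  have h2 := h.two_le
  have h3 := h.add_three_le
  obtain ⟨H, hHX, hH⟩ := Submodule.exists_le_finrank_eq X (d := k - 2) (by omega)
  have hHc := card_vanishingCoords_add_finrank_le H
  obtain ⟨t, ht, ht2, htc⟩ : ∃ t ⊆ vanishingCoords H, t.card ≤ 2 ∧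
      (vanishingCoords H \ t).card ≤ n - k := by
    by_cases hc : (vanishingCoords H).card ≤ 2
    · exact ⟨_, subset_rfl, hc, by simp⟩
    · obtain ⟨t, ht, htc⟩ := Finset.exists_subset_card_eq (s := vanishingCoords H) (n := 2)
        (by omega)
      exact ⟨t, ht, htc.le, by rw [Finset.card_sdiff_of_subset ht]; omega⟩
  obtain ⟨y, hyY, hy⟩ := Submodule.exists_mem_forall_notMem_of_card_le h.exists_notMem Y
    (insert X (t.image (coordHyp F n)))
    ((Finset.card_insert_le _ _).trans (by
      have := Finset.card_image_le (s := t) (f := coordHyp F n)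
      omega))
    (by
      intro p hp
      rcases Finset.mem_insert.1 hp with rfl | hp
      · intro hle
        have := Submodule.finrank_mono hle
        omega
      · obtain ⟨i, -, rfl⟩ := Finset.mem_image.1 hp
        exact hY.not_le i)
  have hyX : y ∉ X := hy X (Finset.mem_insert_self _ _)
  have hyspan : F ∙ y ≤ Y := (Submodule.span_singleton_le_iff_mem y Y).2 hyY
  have hZk : finrank F ↥(H ⊔ F ∙ y) = k - 1 := by
    rw [Submodule.finrank_sup_span_singleton fun hyH => hyX (hHX hyH)]
    omega
  have hPk : finrank F ↥(X ⊔ F ∙ y) = k := by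
    rw [Submodule.finrank_sup_span_singleton hyX]
    omega
  have hZc : (vanishingCoords (H ⊔ F ∙ y)).card ≤ n - k := by
    refine (Finset.card_le_card fun i hi => ?_).trans htc
    rw [mem_vanishingCoords] at hi
    refine Finset.mem_sdiff.2 ⟨mem_vanishingCoords.2 (le_sup_left.trans hi), fun hit => ?_⟩
    exact hy _ (Finset.mem_insert_of_mem (Finset.mem_image_of_mem _ hit))
      (hi (Submodule.mem_sup_right (Submodule.mem_span_singleton_self y)))
  have hYP : ¬ Y ≤ X ⊔ F ∙ y := fun hle => by
    have := Submodule.finrank_mono hle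
    omega
  obtain ⟨y', hyY', hyP', hA⟩ :=
    exists_notMem_isNondeg_sup_span_singleton h.exists_notMem hY hYP hZc
  have hAk : finrank F ↥((H ⊔ F ∙ y) ⊔ F ∙ y') = k := by
    rw [Submodule.finrank_sup_span_singleton fun hmem => hyP' (sup_le_sup_right hHX _ hmem)]
    omega
  refine ⟨_, ⟨hAk, sup_le (sup_le (hHX.trans hXY) hyspan)
    ((Submodule.span_singleton_le_iff_mem _ Y).2 hyY'), hA⟩, fun hle => hyP' ?_⟩
  rw [Submodule.eq_of_le_of_finrank_eq (sup_le hle (le_sup_right.trans le_sup_left))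
    (hPk.trans hAk.symm)]
  exact Submodule.mem_sup_right (Submodule.mem_span_singleton_self y')

theorem nonempty_Tc (h : AdmissibleParams F n k) {Y : Submodule F (Fin n → F)}
    (hY : IsNondeg F n Y) (hYk : finrank F Y = k + 1) : (Tc F n k Y).Nonempty := by
  obtain ⟨Z, hZY, hZ⟩ := Submodule.exists_le_finrank_eq Y (d := k - 1) (by omega)
  obtain ⟨A, hA, -⟩ := h.exists_mem_Tc hY hYk hZY hZ
  exact ⟨A, hA⟩

theorem exists_mem_Tc_ne (h : AdmissibleParams F n k) {A Y : Submodule F (Fin n → F)}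
    (hY : IsNondeg F n Y) (hYk : finrank F Y = k + 1) (hAY : A ≤ Y) (hA : finrank F A = k) :
    ∃ B ∈ Tc F n k Y, A ≠ B := by
  obtain ⟨Z, hZA, hZ⟩ := Submodule.exists_le_finrank_eq A (d := k - 1) (by omega)
  obtain ⟨B, hB, hZB⟩ := h.exists_mem_Tc_not_le hY hYk (hZA.trans hAY) hZ
  exact ⟨B, hB, fun hAB => hZB (hAB ▸ hZA)⟩

theorem le_of_Tc_subset (h : AdmissibleParams F n k) {Y W : Submodule F (Fin n → F)}
    (hY : IsNondeg F n Y) (hYk : finrank F Y = k + 1) (hW : Tc F n k Y ⊆ Tc F n k W) :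
    Y ≤ W := by
  obtain ⟨A, hA⟩ := h.nonempty_Tc hY hYk
  obtain ⟨B, hB, hne⟩ := h.exists_mem_Tc_ne hY hYk hA.2.1 hA.1
  rw [← Submodule.sup_eq_of_ne_of_finrank_eq hA.1 hB.1 hYk hA.2.1 hB.2.1 hne]
  exact sup_le (hW hA).2.1 (hW hB).2.1

theorem Tc_injective (h : AdmissibleParams F n k) {Y W : Submodule F (Fin n → F)}
    (hY : IsNondeg F n Y) (hYk : finrank F Y = k + 1) (hW : IsNondeg F n W)
    (hWk : finrank F W = k + 1) (heq : Tc F n k Y = Tc F n k W) : Y = W :=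
  le_antisymm (h.le_of_Tc_subset hY hYk heq.subset) (h.le_of_Tc_subset hW hWk heq.symm.subset)

theorem adjK_of_le (h : AdmissibleParams F n k) {A B Y : Submodule F (Fin n → F)}
    (hA : finrank F A = k) (hB : finrank F B = k) (hYk : finrank F Y = k + 1) (hAY : A ≤ Y)
    (hBY : B ≤ Y) (hne : A ≠ B) : AdjK F n k A B := by
  have := h.two_le
  have := Submodule.finrank_inf_add_one hA hB hYk hAY hBY hne
  exact ⟨hne, by omega⟩

theorem adjK_of_ge (h : AdmissibleParams F n k) {A B Z : Submodule F (Fin n → F)}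
    (hA : finrank F A = k) (hB : finrank F B = k) (hZ : finrank F Z = k - 1) (hZA : Z ≤ A)
    (hZB : Z ≤ B) (hne : A ≠ B) : AdjK F n k A B := by
  have := h.two_le
  have h1 := Submodule.finrank_mono (le_inf hZA hZB)
  have h2 := Submodule.add_one_le_finrank_sup_of_ne hA hB hne
  have h3 := Submodule.finrank_sup_add_finrank_inf_eq A B
  exact ⟨hne, by omega⟩

theorem isTopD_Tc (h : AdmissibleParams F n k) {Y : Submodule F (Fin n → F)}
    (hY : IsNondeg F n Y) (hYk : finrank F Y = k + 1) : IsTopD F n k (Tc F n k Y) := by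
  have h2 := h.two_le
  refine ⟨⟨Y, hYk, rfl⟩, ⟨fun A hA => ⟨hA.1, hA.2.2⟩, fun A hA B hB hne =>
    h.adjK_of_le hA.1 hB.1 hYk hA.2.1 hB.2.1 hne⟩, fun D hD hYD => ?_⟩
  refine Set.Subset.antisymm (fun B hB => ⟨(hD.1 B hB).1, ?_, (hD.1 B hB).2⟩) hYD
  by_contra hBY
  have hinf : ∀ A ∈ Tc F n k Y, A ⊓ B ≤ B ⊓ Y ∧ finrank F ↥(A ⊓ B) = k - 1 := by
    intro A hA
    exact ⟨le_inf inf_le_right (inf_le_left.trans hA.2.1),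
      (hD.2 A (hYD hA) B hB fun hAB => hBY (hAB ▸ hA.2.1)).2⟩
  have hX : finrank F ↥(B ⊓ Y) = k - 1 := by
    obtain ⟨A, hA⟩ := h.nonempty_Tc hY hYk
    have h1 := Submodule.finrank_mono (hinf A hA).1
    have h3 := Submodule.finrank_lt_finrank_of_lt
      (lt_of_le_of_ne inf_le_left fun he => hBY (inf_eq_left.1 he) : B ⊓ Y < B)
    have := (hinf A hA).2
    have := (hD.1 B hB).1
    omega
  obtain ⟨A, hA, hXA⟩ := h.exists_mem_Tc_not_le hY hYk inf_le_right hX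
  have := Submodule.eq_of_le_of_finrank_eq (hinf A hA).1 ((hinf A hA).2.trans hX.symm)
  exact hXA (this ▸ inf_le_left)

theorem isTopD_iff (h : AdmissibleParams F n k) {T : Set (Submodule F (Fin n → F))} :
    IsTopD F n k T ↔
      ∃ Y : Submodule F (Fin n → F), finrank F Y = k + 1 ∧ IsNondeg F n Y ∧ T = Tc F n k Y := by
  refine ⟨fun hT => ?_, fun ⟨Y, hYk, hY, hT⟩ => hT ▸ h.isTopD_Tc hY hYk⟩
  obtain ⟨⟨Y, hYk, rfl⟩, hmax⟩ := hT
  refine ⟨Y, hYk, fun hdeg => ?_, rfl⟩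
  have hempty : Tc F n k Y = ∅ :=
    Set.eq_empty_of_forall_notMem fun A hA => hA.2.2.mono hA.2.1 hdeg
  have h3 := h.add_three_le
  obtain ⟨Z, -, hZ⟩ := Submodule.exists_le_finrank_eq Y (d := k - 1) (by omega)
  obtain ⟨y, hyZ, hy⟩ := h.exists_notMem_forall_ne_zero (W := Z) (by omega)
  have h2 := h.two_le
  have hclique : IsCliqueD F n k {Z ⊔ F ∙ y} := by
    refine ⟨fun A hA => ?_, fun A hA B hB hne => (hne (hA.trans hB.symm)).elim⟩
    rw [Set.mem_singleton_iff.1 hA]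
    exact ⟨by rw [Submodule.finrank_sup_span_singleton hyZ]; omega,
      isNondeg_sup_span_singleton_of_forall_ne_zero Z hy⟩
  have := hmax.2 _ hclique (by simp [hempty])
  exact Set.singleton_ne_empty _ (this.trans hempty)

theorem adjMC_Tc_iff (h : AdmissibleParams F n k) {Y W : Submodule F (Fin n → F)}
    (hY : IsNondeg F n Y) (hYk : finrank F Y = k + 1) (hW : IsNondeg F n W)
    (hWk : finrank F W = k + 1) :
    AdjMC F n k (Tc F n k Y) (Tc F n k W) ↔ Y ≠ W ∧ finrank F ↥(Y ⊓ W) = k := by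
  have h2 := h.two_le
  constructor
  · rintro ⟨hne, hadj, -⟩
    have hYW : Y ≠ W := fun he => hne (he ▸ rfl)
    refine ⟨hYW, ?_⟩
    have hinf : ∀ A ∈ Tc F n k Y, ∃ X ≤ Y ⊓ W, X ≤ A ∧ finrank F X = k - 1 := by
      intro A hA
      obtain ⟨B, hB, hAB⟩ := hadj A hA
      exact ⟨A ⊓ B, inf_le_inf hA.2.1 hB.2.1, inf_le_left, hAB.2⟩
    have hle : finrank F ↥(Y ⊓ W) < k + 1 := hYk ▸ Submodule.finrank_lt_finrank_of_lt
      (lt_of_le_of_ne inf_le_left fun he =>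
        hYW (Submodule.eq_of_le_of_finrank_eq (inf_eq_left.1 he) (hYk.trans hWk.symm)))
    have hge : k - 1 ≤ finrank F ↥(Y ⊓ W) := by
      obtain ⟨A, hA⟩ := h.nonempty_Tc hY hYk
      obtain ⟨X, hX, -, hXk⟩ := hinf A hA
      exact hXk ▸ Submodule.finrank_mono hX
    have hnot : finrank F ↥(Y ⊓ W) ≠ k - 1 := by
      intro hk
      obtain ⟨A, hA, hnot⟩ := h.exists_mem_Tc_not_le hY hYk inf_le_left hk
      obtain ⟨X, hX, hXA, hXk⟩ := hinf A hA
      exact hnot (Submodule.eq_of_le_of_finrank_eq hX (hXk.trans hk.symm) ▸ hXA)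
    omega
  · rintro ⟨hne, hinf⟩
    have key : ∀ {Y W : Submodule F (Fin n → F)}, IsNondeg F n Y → finrank F Y = k + 1 →
        IsNondeg F n W → finrank F W = k + 1 → finrank F ↥(Y ⊓ W) = k →
        ∀ A ∈ Tc F n k Y, ∃ B ∈ Tc F n k W, AdjK F n k A B := by
      intro Y W hY hYk hW hWk hinf A hA
      by_cases hAW : A ≤ W
      · obtain ⟨B, hB, hne⟩ := h.exists_mem_Tc_ne hW hWk hAW hA.1
        exact ⟨B, hB, h.adjK_of_le hA.1 hB.1 hWk hAW hB.2.1 hne⟩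
      · have hZ : finrank F ↥(A ⊓ (Y ⊓ W)) = k - 1 := by
          have := Submodule.finrank_inf_add_one hA.1 hinf hYk hA.2.1 inf_le_left
            fun he => hAW (he ▸ inf_le_right)
          omega
        obtain ⟨B, hB, hZB⟩ := h.exists_mem_Tc hW hWk (inf_le_right.trans inf_le_right) hZ
        exact ⟨B, hB, h.adjK_of_ge hA.1 hB.1 hZ inf_le_left hZB
          fun he => hAW (he ▸ hB.2.1)⟩
    exact ⟨fun he => hne (h.Tc_injective hY hYk hW hWk he), key hY hYk hW hWk hinf,
      key hW hWk hY hYk (inf_comm Y W ▸ hinf)⟩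

theorem adjMC'_Tc_iff (h : AdmissibleParams F n k) {Y W : Submodule F (Fin n → F)}
    (hY : IsNondeg F n Y) (hYk : finrank F Y = k + 1) (hW : IsNondeg F n W)
    (hWk : finrank F W = k + 1) :
    AdjMC' F n k (Tc F n k Y) (Tc F n k W) ↔
      Y ≠ W ∧ finrank F ↥(Y ⊓ W) = k ∧ IsDeg F n (Y ⊓ W) := by
  rw [AdjMC', h.adjMC_Tc_iff hY hYk hW hWk, and_assoc]
  refine and_congr_right fun _ => and_congr_right fun hk => ⟨fun he => ?_, fun hdeg => ?_⟩
  · by_contra hnd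
    exact Set.notMem_empty (Y ⊓ W) (he ▸ ⟨⟨hk, inf_le_left, hnd⟩, ⟨hk, inf_le_right, hnd⟩⟩)
  · exact Set.eq_empty_of_forall_notMem fun A hA =>
      hA.1.2.2.mono (le_inf hA.1.2.1 hA.2.2.1) hdeg

end AdmissibleParams

namespace AdmissibleParams

variable {F : Type*} [Field F] {n k : ℕ}

theorem exists_isNondeg_not_le (h : AdmissibleParams F n k) {X P : Submodule F (Fin n → F)}
    (hX : finrank F X = k) (hXP : X ≤ P) (hP : finrank F P < n) :
    ∃ Y, X ≤ Y ∧ ¬ Y ≤ P ∧ IsNondeg F n Y ∧ finrank F Y = k + 1 := by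
  obtain ⟨y, hyP, hy⟩ := h.exists_notMem_forall_ne_zero hP
  refine ⟨X ⊔ F ∙ y, le_sup_left, fun hle => hyP ?_,
    isNondeg_sup_span_singleton_of_forall_ne_zero X hy, ?_⟩
  · exact hle (Submodule.mem_sup_right (Submodule.mem_span_singleton_self y))
  · rw [Submodule.finrank_sup_span_singleton fun hyX => hyP (hXP hyX), hX]

theorem le_of_forall_isNondeg (h : AdmissibleParams F n k) {X Z : Submodule F (Fin n → F)}
    (hX : finrank F X = k)
    (hZ : ∀ Y, X ≤ Y → IsNondeg F n Y → finrank F Y = k + 1 → Z ≤ Y) : Z ≤ X := by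
  have h3 := h.add_three_le
  by_contra hZX
  have hlt := Submodule.finrank_lt_finrank_of_lt
    (lt_of_le_of_ne le_sup_left fun he => hZX (sup_eq_left.1 he.symm) : X < X ⊔ Z)
  have hP : ∀ Y, X ≤ Y → IsNondeg F n Y → finrank F Y = k + 1 → X ⊔ Z = Y := fun Y hXY hY hYk =>
    Submodule.eq_of_le_of_finrank_le (sup_le hXY (hZ Y hXY hY hYk)) (by omega)
  obtain ⟨Y, hXY, -, hY, hYk⟩ := h.exists_isNondeg_not_le hX le_rfl (by omega)
  have hPk : finrank F ↥(X ⊔ Z) = k + 1 := hP Y hXY hY hYk ▸ hYk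
  obtain ⟨W, hXW, hWP, hW, hWk⟩ :=
    h.exists_isNondeg_not_le (P := X ⊔ Z) hX le_sup_left (by omega)
  exact hWP (hP W hXW hW hWk).ge

theorem inf_eq_of_le {X : Submodule F (Fin n → F)} (hX : finrank F X = k)
    {Y W : Submodule F (Fin n → F)} (hYk : finrank F Y = k + 1) (hWk : finrank F W = k + 1)
    (hXY : X ≤ Y) (hXW : X ≤ W) (hne : Y ≠ W) : Y ⊓ W = X := by
  have h1 := Submodule.add_one_le_finrank_sup_of_ne hYk hWk hne
  have h2 := Submodule.finrank_sup_add_finrank_inf_eq Y W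
  exact (Submodule.eq_of_le_of_finrank_le (le_inf hXY hXW) (by omega)).symm

theorem isSpecialTops_topsThrough (h : AdmissibleParams F n k) {X : Submodule F (Fin n → F)}
    (hX : finrank F X = k) (hdeg : IsDeg F n X) : IsSpecialTops F n k (TopsThrough F n k X) := by
  have h3 := h.add_three_le
  have htop : ∀ T ∈ TopsThrough F n k X, IsTopD F n k T := by
    rintro _ ⟨Y, hYk, hY, -, rfl⟩
    exact h.isTopD_Tc hY hYk
  have hclique : IsCliqueDt' F n k (TopsThrough F n k X) := by
    refine ⟨htop, ?_⟩
    rintro _ ⟨Y, hYk, hY, hXY, rfl⟩ _ ⟨W, hWk, hW, hXW, rfl⟩ hne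
    have hYW : Y ≠ W := fun he => hne (he ▸ rfl)
    rw [h.adjMC'_Tc_iff hY hYk hW hWk, inf_eq_of_le hX hYk hWk hXY hXW hYW]
    exact ⟨hYW, hX, hdeg⟩
  have hmax : IsMaxCliqueDt F n k (TopsThrough F n k X) := by
    refine ⟨⟨htop, fun T hT T' hT' hne => (hclique.2 T hT T' hT' hne).1⟩, fun 𝔗 h𝔗 hsub => ?_⟩
    refine Set.Subset.antisymm (fun T hT => ?_) hsub
    obtain ⟨Y, hYk, hY, rfl⟩ := h.isTopD_iff.1 (h𝔗.1 T hT)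
    refine ⟨Y, hYk, hY, ?_, rfl⟩
    by_contra hXY
    have hadj : ∀ W, X ≤ W → IsNondeg F n W → finrank F W = k + 1 → finrank F ↥(Y ⊓ W) = k := by
      intro W hXW hW hWk
      refine ((h.adjMC_Tc_iff hY hYk hW hWk).1 (h𝔗.2 _ hT _ (hsub ⟨W, hWk, hW, hXW, rfl⟩)
        fun he => hXY ?_)).2
      rwa [h.Tc_injective hY hYk hW hWk he]
    obtain ⟨W, hXW, -, hW, hWk⟩ := h.exists_isNondeg_not_le hX le_rfl (by omega)
    have hP : finrank F ↥(X ⊔ Y) < n := by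
      have h1 := Submodule.finrank_mono (sup_le_sup_right hXW Y)
      have h4 := Submodule.finrank_sup_eq_add_one hYk hWk (by rw [hadj W hXW hW hWk])
      rw [sup_comm] at h4
      omega
    obtain ⟨W, hXW, hWP, hW, hWk⟩ := h.exists_isNondeg_not_le hX le_sup_left hP
    refine hWP ?_
    rw [← Submodule.sup_eq_of_ne_of_finrank_eq hX (hadj W hXW hW hWk) hWk hXW inf_le_right
      fun he => hXY (he ▸ inf_le_left)]
    exact sup_le_sup_left inf_le_left X
  refine ⟨hmax, hclique, fun 𝔗 h𝔗 hsub => hmax.2 𝔗 ⟨h𝔗.1, fun T hT T' hT' hne =>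
    (h𝔗.2 T hT T' hT' hne).1⟩ hsub⟩

theorem topsThrough_injective (h : AdmissibleParams F n k) {X X' : Submodule F (Fin n → F)}
    (hX : finrank F X = k) (hX' : finrank F X' = k)
    (heq : TopsThrough F n k X = TopsThrough F n k X') : X = X' := by
  refine (Submodule.eq_of_le_of_finrank_eq (h.le_of_forall_isNondeg hX fun Y hXY hY hYk => ?_)
    (hX'.trans hX.symm)).symm
  have hmem : Tc F n k Y ∈ TopsThrough F n k X' := heq ▸ ⟨Y, hYk, hY, hXY, rfl⟩
  obtain ⟨W, hWk, hW, hXW, he⟩ := hmem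
  rwa [h.Tc_injective hY hYk hW hWk he]

theorem Tc_mem_of_isMaxCliqueDt (h : AdmissibleParams F n k)
    {𝔗 : Set (Set (Submodule F (Fin n → F)))} (h𝔗 : IsMaxCliqueDt F n k 𝔗)
    {Y : Submodule F (Fin n → F)} (hY : IsNondeg F n Y) (hYk : finrank F Y = k + 1)
    (hadj : ∀ W, IsNondeg F n W → finrank F W = k + 1 → Tc F n k W ∈ 𝔗 → Y ≠ W →
      finrank F ↥(Y ⊓ W) = k) : Tc F n k Y ∈ 𝔗 := by
  have hAdj : ∀ T ∈ 𝔗, Tc F n k Y ≠ T → AdjMC F n k (Tc F n k Y) T := by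
    intro T hT hne
    obtain ⟨W, hWk, hW, rfl⟩ := h.isTopD_iff.1 (h𝔗.1.1 T hT)
    have hYW : Y ≠ W := fun he => hne (he ▸ rfl)
    exact (h.adjMC_Tc_iff hY hYk hW hWk).2 ⟨hYW, hadj W hW hWk hT hYW⟩
  rw [← h𝔗.2 (insert (Tc F n k Y) 𝔗) ⟨?_, ?_⟩ (Set.subset_insert _ _)]
  · exact Set.mem_insert _ _
  · rintro T (rfl | hT)
    · exact h.isTopD_Tc hY hYk
    · exact h𝔗.1.1 T hT
  · rintro T (rfl | hT) T' (rfl | hT') hne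
    · exact (hne rfl).elim
    · exact hAdj T' hT' hne
    · obtain ⟨h1, h2, h3⟩ := hAdj T hT hne.symm
      exact ⟨hne, h3, h2⟩
    · exact h𝔗.1.2 T hT T' hT' hne

theorem isSpecialTops_iff (h : AdmissibleParams F n k)
    {𝔗 : Set (Set (Submodule F (Fin n → F)))} :
    IsSpecialTops F n k 𝔗 ↔ ∃ X : Submodule F (Fin n → F),
      finrank F X = k ∧ IsDeg F n X ∧ 𝔗 = TopsThrough F n k X := by
  refine ⟨fun ⟨hmax, hmax'⟩ => ?_, fun ⟨X, hX, hdeg, h𝔗⟩ =>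
    h𝔗 ▸ h.isSpecialTops_topsThrough hX hdeg⟩
  have h2 := h.two_le
  have h3 := h.add_three_le
  have hadj : ∀ {Y W}, IsNondeg F n Y → finrank F Y = k + 1 → IsNondeg F n W →
      finrank F W = k + 1 → Tc F n k Y ∈ 𝔗 → Tc F n k W ∈ 𝔗 → Y ≠ W →
      finrank F ↥(Y ⊓ W) = k ∧ IsDeg F n (Y ⊓ W) := fun hY hYk hW hWk hYT hWT hne =>
    ((h.adjMC'_Tc_iff hY hYk hW hWk).1 (hmax'.1.2 _ hYT _ hWT
      fun he => hne (h.Tc_injective hY hYk hW hWk he))).2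
  obtain ⟨Y₁, hY₁, hY₁k, hY₁T⟩ : ∃ Y, IsNondeg F n Y ∧ finrank F Y = k + 1 ∧ Tc F n k Y ∈ 𝔗 := by
    by_contra! hcon
    obtain ⟨Z, -, hZ⟩ := Submodule.exists_le_finrank_eq (⊤ : Submodule F (Fin n → F)) (d := k)
      (by simp; omega)
    obtain ⟨Y, -, -, hY, hYk⟩ := h.exists_isNondeg_not_le hZ le_rfl (by omega)
    exact hcon Y hY hYk (h.Tc_mem_of_isMaxCliqueDt hmax hY hYk fun W hW hWk hWT _ =>
      (hcon W hW hWk hWT).elim)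
  obtain ⟨A, hA⟩ := h.nonempty_Tc hY₁ hY₁k
  obtain ⟨Y₂, hY₂, hY₂k, hY₂T, hne⟩ :
      ∃ Y, IsNondeg F n Y ∧ finrank F Y = k + 1 ∧ Tc F n k Y ∈ 𝔗 ∧ Y₁ ≠ Y := by
    by_contra! hcon
    obtain ⟨Y, hAY, hYY₁, hY, hYk⟩ := h.exists_isNondeg_not_le hA.1 hA.2.1 (by omega)
    have hYT := h.Tc_mem_of_isMaxCliqueDt hmax hY hYk fun W hW hWk hWT hYW => by
      rw [← hcon W hW hWk hWT] at hYW ⊢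
      rw [inf_eq_of_le hA.1 hYk hY₁k hAY hA.2.1 hYW, hA.1]
    exact hYY₁ (hcon Y hY hYk hYT).ge
  obtain ⟨hX, hdeg⟩ := hadj hY₁ hY₁k hY₂ hY₂k hY₁T hY₂T hne
  refine ⟨Y₁ ⊓ Y₂, hX, hdeg, ?_⟩
  by_cases hall : ∀ Y, IsNondeg F n Y → finrank F Y = k + 1 → Tc F n k Y ∈ 𝔗 → Y₁ ⊓ Y₂ ≤ Y
  · refine (hmax.2 _ (h.isSpecialTops_topsThrough hX hdeg).1.1 fun T hT => ?_).symm
    obtain ⟨Y, hYk, hY, rfl⟩ := h.isTopD_iff.1 (hmax.1.1 T hT)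
    exact ⟨Y, hYk, hY, hall Y hY hYk hT, rfl⟩
  exfalso
  push Not at hall
  obtain ⟨Y₃, hY₃, hY₃k, hY₃T, hXY₃⟩ := hall
  have hWk := Submodule.finrank_sup_eq_add_one hY₁k hY₂k (by rw [hX])
  have hsplit : ∀ {Y P Q : Submodule F (Fin n → F)}, finrank F Y = k + 1 →
      finrank F ↥(Y ⊓ P) = k → finrank F ↥(Y ⊓ Q) = k → Y ⊓ P ≠ Y ⊓ Q →
      P ≤ Y₁ ⊔ Y₂ → Q ≤ Y₁ ⊔ Y₂ → Y ≤ Y₁ ⊔ Y₂ := by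
    intro Y P Q hYk hP hQ hPQ hPW hQW
    rw [← Submodule.sup_eq_of_ne_of_finrank_eq hP hQ hYk inf_le_left inf_le_left hPQ]
    exact sup_le (inf_le_right.trans hPW) (inf_le_right.trans hQW)
  have hX_le : ∀ {Y : Submodule F (Fin n → F)}, finrank F ↥(Y ⊓ Y₁) = k → Y ⊓ Y₁ = Y ⊓ Y₂ →
      Y ⊓ Y₁ = Y₁ ⊓ Y₂ := fun hY he =>
    Submodule.eq_of_le_of_finrank_eq (le_inf inf_le_right (he ▸ inf_le_right)) (hY.trans hX.symm)
  have h31 := (hadj hY₃ hY₃k hY₁ hY₁k hY₃T hY₁T fun he => hXY₃ (he ▸ inf_le_left)).1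
  have h32 := (hadj hY₃ hY₃k hY₂ hY₂k hY₃T hY₂T fun he => hXY₃ (he ▸ inf_le_right)).1
  have hY₃W : Y₃ ≤ Y₁ ⊔ Y₂ := hsplit hY₃k h31 h32
    (fun he => hXY₃ (hX_le h31 he ▸ inf_le_left)) le_sup_left le_sup_right
  have hall : ∀ Y, IsNondeg F n Y → finrank F Y = k + 1 → Tc F n k Y ∈ 𝔗 → Y ≤ Y₁ ⊔ Y₂ := by
    intro Y hY hYk hYT
    by_cases e1 : Y = Y₁
    · exact e1 ▸ le_sup_left
    by_cases e2 : Y = Y₂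
    · exact e2 ▸ le_sup_right
    by_cases e3 : Y = Y₃
    · exact e3 ▸ hY₃W
    have i1 := (hadj hY hYk hY₁ hY₁k hYT hY₁T e1).1
    have i2 := (hadj hY hYk hY₂ hY₂k hYT hY₂T e2).1
    have i3 := (hadj hY hYk hY₃ hY₃k hYT hY₃T e3).1
    by_cases he : Y ⊓ Y₁ = Y ⊓ Y₂
    · exact hsplit hYk i1 i3 (fun he' => hXY₃ (hX_le i1 he ▸ he' ▸ inf_le_right))
        le_sup_left hY₃W
    · exact hsplit hYk i1 i2 he le_sup_left le_sup_right
  have hWY₁ : ¬ Y₁ ⊔ Y₂ ≤ Y₁ := fun hle => by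
    have := Submodule.finrank_mono hle
    omega
  obtain ⟨y, hyW, hyY₁⟩ := SetLike.not_le_iff_exists.1 hWY₁
  have hY : IsNondeg F n (A ⊔ F ∙ y) := hA.2.2.mono le_sup_left
  have hYk : finrank F ↥(A ⊔ F ∙ y) = k + 1 := by
    rw [Submodule.finrank_sup_span_singleton fun hyA => hyY₁ (hA.2.1 hyA), hA.1]
  have hYW : A ⊔ F ∙ y ≤ Y₁ ⊔ Y₂ := sup_le (hA.2.1.trans le_sup_left)
    ((Submodule.span_singleton_le_iff_mem y _).2 hyW)
  have hYT := h.Tc_mem_of_isMaxCliqueDt hmax hY hYk fun W hW hWk' hWT hne => by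
    simpa using Submodule.finrank_inf_add_one hYk hWk' hWk hYW (hall W hW hWk' hWT) hne
  refine (hA.2.2.mono (le_inf le_sup_left hA.2.1)) (hadj hY hYk hY₁ hY₁k hYT hY₁T fun he =>
    hyY₁ ?_).2
  rw [← he]
  exact Submodule.mem_sup_right (Submodule.mem_span_singleton_self y)

theorem isStarD_Sc (h : AdmissibleParams F n k) {Z : Submodule F (Fin n → F)}
    (hZ : finrank F Z = k - 1) : IsStarD F n k (Sc F n k Z) := by
  have h2 := h.two_le
  have h3 := h.add_three_le
  have hexists : ∀ P : Submodule F (Fin n → F), finrank F P < n → Z ≤ P →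
      ∃ A ∈ Sc F n k Z, ¬ A ≤ P := by
    intro P hP hZP
    obtain ⟨y, hyP, hy⟩ := h.exists_notMem_forall_ne_zero hP
    refine ⟨Z ⊔ F ∙ y, ⟨?_, le_sup_left, isNondeg_sup_span_singleton_of_forall_ne_zero Z hy⟩,
      fun hle => hyP (hle (Submodule.mem_sup_right (Submodule.mem_span_singleton_self y)))⟩
    rw [Submodule.finrank_sup_span_singleton fun hyZ => hyP (hZP hyZ)]
    omega
  refine ⟨⟨Z, hZ, rfl⟩, ⟨fun A hA => ⟨hA.1, hA.2.2⟩, fun A hA B hB hne =>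
    h.adjK_of_ge hA.1 hB.1 hZ hA.2.1 hB.2.1 hne⟩, fun D hD hZD => ?_⟩
  refine Set.Subset.antisymm (fun B hB => ⟨(hD.1 B hB).1, ?_, (hD.1 B hB).2⟩) hZD
  by_contra hZB
  have hBk := (hD.1 B hB).1
  have hsup : ∀ A ∈ Sc F n k Z, finrank F ↥(B ⊔ A) = k + 1 ∧ B ⊔ Z = B ⊔ A := by
    intro A hA
    have hBA := hD.2 B hB A (hZD hA) fun he => hZB (he ▸ hA.2.1)
    have hk := Submodule.finrank_sup_eq_add_one hBk hA.1 (by rw [hBA.2]; omega)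
    have hlt := Submodule.finrank_lt_finrank_of_lt
      (lt_of_le_of_ne le_sup_left fun he => hZB (sup_eq_left.1 he.symm) : B < B ⊔ Z)
    exact ⟨hk, Submodule.eq_of_le_of_finrank_le (sup_le_sup_left hA.2.1 B) (by omega)⟩
  obtain ⟨A, hA, -⟩ := hexists Z (by omega) le_rfl
  obtain ⟨hk, he⟩ := hsup A hA
  obtain ⟨A', hA', hnot⟩ := hexists (B ⊔ Z) (by rw [he]; omega) le_sup_right
  exact hnot ((hsup A' hA').2 ▸ le_sup_right)

theorem exists_mem_topsThrough_iff (h : AdmissibleParams F n k)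
    {A X : Submodule F (Fin n → F)} (hAk : finrank F A = k) (hA : IsNondeg F n A)
    (hX : finrank F X = k) (hdeg : IsDeg F n X) :
    (∃ T ∈ TopsThrough F n k X, A ∈ T) ↔ finrank F ↥(A ⊓ X) = k - 1 := by
  have h2 := h.two_le
  constructor
  · rintro ⟨_, ⟨Y, hYk, hY, hXY, rfl⟩, hAY⟩
    exact (h.adjK_of_le hAk hX hYk hAY.2.1 hXY fun he => hA (he ▸ hdeg)).2
  · intro hk
    exact ⟨_, ⟨A ⊔ X, Submodule.finrank_sup_eq_add_one hAk hX (by omega), hA.mono le_sup_left,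
      le_sup_right, rfl⟩, hAk, le_sup_left, hA⟩

theorem exists_isStarD_iff (h : AdmissibleParams F n k) {X X' : Submodule F (Fin n → F)}
    (hX : finrank F X = k) (hX' : finrank F X' = k) (hne : X ≠ X') :
    (∃ S, IsStarD F n k S ∧ (∀ T ∈ TopsThrough F n k X, (S ∩ T).Nonempty) ∧
      (∀ T ∈ TopsThrough F n k X', (S ∩ T).Nonempty)) ↔ finrank F ↥(X ⊓ X') = k - 1 := by
  constructor
  · rintro ⟨_, ⟨⟨Z, hZ, rfl⟩, -⟩, hS, hS'⟩
    have hle : ∀ {X : Submodule F (Fin n → F)}, finrank F X = k →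
        (∀ T ∈ TopsThrough F n k X, (Sc F n k Z ∩ T).Nonempty) → Z ≤ X := by
      intro X hX hS
      refine h.le_of_forall_isNondeg hX fun Y hXY hY hYk => ?_
      obtain ⟨A, hAZ, hAY⟩ := hS _ ⟨Y, hYk, hY, hXY, rfl⟩
      exact hAZ.2.1.trans hAY.2.1
    exact (h.adjK_of_ge hX hX' hZ (hle hX hS) (hle hX' hS') hne).2
  · intro hZ
    have hmeet : ∀ {X₀}, X ⊓ X' ≤ X₀ → ∀ T ∈ TopsThrough F n k X₀,
        (Sc F n k (X ⊓ X') ∩ T).Nonempty := by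
      rintro X₀ hle _ ⟨Y, hYk, hY, hXY, rfl⟩
      obtain ⟨A, hA, hZA⟩ := h.exists_mem_Tc hY hYk (hle.trans hXY) hZ
      exact ⟨A, ⟨hA.1, hZA, hA.2.2⟩, hA⟩
    exact ⟨_, h.isStarD_Sc hZ, hmeet inf_le_left, hmeet inf_le_right⟩

theorem exists_iso (h : AdmissibleParams F n k) :
    ∃ φ : GammaT F n k ≃g GrassmannGraph F n k,
      ∀ A : {A : Submodule F (Fin n → F) // finrank F ↥A = k ∧ IsNondeg F n A},
        (φ (Sum.inl A)).1 = A.1 := by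
  choose g hgk hgdeg hg using fun 𝔗 : {𝔗 // IsSpecialTops F n k 𝔗} => h.isSpecialTops_iff.1 𝔗.2
  let f : {A : Submodule F (Fin n → F) // finrank F A = k ∧ IsNondeg F n A} ⊕
      {𝔗 : Set (Set (Submodule F (Fin n → F))) // IsSpecialTops F n k 𝔗} →
      {A : Submodule F (Fin n → F) // finrank F A = k} :=
    Sum.elim (fun A => ⟨A.1, A.2.1⟩) fun 𝔗 => ⟨g 𝔗, hgk 𝔗⟩
  have hinj : Function.Injective f := by
    rintro (A | 𝔗) (B | 𝔗') he <;> have he' := congrArg Subtype.val he <;>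
      simp only [f, Sum.elim_inl, Sum.elim_inr] at he'
    · exact congrArg Sum.inl (Subtype.ext he')
    · exact (A.2.2 (he' ▸ hgdeg 𝔗')).elim
    · exact (B.2.2 (he' ▸ hgdeg 𝔗)).elim
    · exact congrArg Sum.inr (Subtype.ext (by rw [hg 𝔗, hg 𝔗', he']))
  have hsurj : Function.Surjective f := by
    rintro ⟨X, hX⟩
    by_cases hdeg : IsDeg F n X
    · refine ⟨Sum.inr ⟨_, h.isSpecialTops_topsThrough hX hdeg⟩, Subtype.ext ?_⟩
      exact h.topsThrough_injective (hgk _) hX (hg _).symm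
    · exact ⟨Sum.inl ⟨X, hX, hdeg⟩, rfl⟩
  have hinter : ∀ A B : Submodule F (Fin n → F),
      (finrank F ↥(A ⊓ B) = k - 1 ∨ finrank F ↥(B ⊓ A) = k - 1) ↔ finrank F ↥(A ⊓ B) = k - 1 :=
    fun A B => by rw [inf_comm B A, or_self]
  refine ⟨⟨Equiv.ofBijective f ⟨hinj, hsurj⟩, ?_⟩, fun A => rfl⟩
  intro v w
  change (GrassmannGraph F n k).Adj (f v) (f w) ↔ _
  simp only [GrassmannGraph, GammaT, SimpleGraph.fromRel_adj, hinj.ne_iff, hinter]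
  refine and_congr_right fun hne => ?_
  rcases v with A | 𝔗 <;> rcases w with B | 𝔗'
  · change finrank F ↥(A.1 ⊓ B.1) = k - 1 ↔ _
    have hAB : A.1 ≠ B.1 := fun he => hne (congrArg Sum.inl (Subtype.ext he))
    simp [AdjK, hAB, hAB.symm, hinter]
  · change finrank F ↥(A.1 ⊓ g 𝔗') = k - 1 ↔ _
    dsimp only
    rw [or_self, hg 𝔗', h.exists_mem_topsThrough_iff A.2.1 A.2.2 (hgk 𝔗') (hgdeg 𝔗')]
  · change finrank F ↥(g 𝔗 ⊓ B.1) = k - 1 ↔ _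
    dsimp only
    rw [or_self, hg 𝔗, h.exists_mem_topsThrough_iff B.2.1 B.2.2 (hgk 𝔗) (hgdeg 𝔗), inf_comm]
  · change finrank F ↥(g 𝔗 ⊓ g 𝔗') = k - 1 ↔ _
    dsimp only
    have hX : g 𝔗 ≠ g 𝔗' := fun he => hne (congrArg Sum.inr (Subtype.ext (by
      rw [hg 𝔗, hg 𝔗', he])))
    rw [hg 𝔗, hg 𝔗', h.exists_isStarD_iff (hgk 𝔗) (hgk 𝔗') hX,
      h.exists_isStarD_iff (hgk 𝔗') (hgk 𝔗) hX.symm, hinter]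

end AdmissibleParams

/-- for `|F| > n - k` and `k ≤ n - 3`, the graph `Γ_t` is isomorphic to
the Grassmann graph `Γ_k(V)` by an isomorphism fixing every non-degenerate `k`-dimensional
subspace. -/
theorem stmt13 (F : Type*) [Field F] (n k : ℕ)
    (hk1 : 1 < k) (hk2 : k < n - 1) (hk3 : k ≤ n - 3)
    (hF : (↑(n - k) : Cardinal) < Cardinal.mk F) :
    ∃ φ : GammaT F n k ≃g GrassmannGraph F n k,
      ∀ A : {A : Submodule F (Fin n → F) // finrank F ↥A = k ∧ IsNondeg F n A},
        (φ (Sum.inl A)).1 = A.1 := by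
  refine AdmissibleParams.exists_iso ⟨hk1, by omega, fun t ht => ?_⟩
  by_contra! hcon
  have hle : Cardinal.mk F ≤ t.card := by
    rw [← Cardinal.mk_coe_finset, ← Cardinal.mk_univ]
    exact Cardinal.mk_le_mk_of_subset fun c _ => hcon c
  exact (hF.trans_le hle).not_ge (Nat.cast_le.2 ht)
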